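/- There exists an absolute constant C > 0 such that for every real U ≥ 2, | Σ_{k ≥ 1, q ≥ 1, k + q < U} φ(q)/(k·q²) − (log U)²/ζ(2) − (log U/ζ(2))·(2γ − ζ′(2)/ζ(2)) | ≤ C, where φ is Euler's totient function, γ the Euler–Mascheroni constant, and ζ the Riemann zeta function. -/

import Mathlib

/-- `ζ'(2)`, the derivative of the Riemann zeta function at `2` (a real number). -/
noncomputable def zetaDeriv2 : ℝ := (deriv riemannZeta 2).re

open Finset ArithmeticFunction in
theorem tds_totient_div (q : ℕ) (hq : 0 < q) :
    ∑ x ∈ q.divisorsAntidiagonal, ((moebius x.1 : ℤ) : ℝ) / (x.1:ℝ)^2 * (1 / (x.2:ℝ)) = (q.totient : ℝ) / (q:ℝ)^2 := by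
  have h := (sum_eq_iff_sum_mul_moebius_eq (R := ℝ) (f := fun n => (n.totient : ℝ)) (g := fun n => (n : ℝ))).1
    (fun n hn => by exact_mod_cast Nat.sum_totient n) q hq
  rw [← h, Finset.sum_div]
  refine Finset.sum_congr rfl fun x hx => ?_
  have hx' := (Nat.mem_divisorsAntidiagonal.1 hx)
  have h1 : (x.1 : ℝ) ≠ 0 := by
    have := hx'.1; have : x.1 ≠ 0 := by rintro h; simp [h] at this; omega
    exact_mod_cast this
  have h2 : (x.2 : ℝ) ≠ 0 := by
    have := hx'.1; have : x.2 ≠ 0 := by rintro h; simp [h] at this; omega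
    exact_mod_cast this
  rw [← hx'.1]; push_cast; field_simp

theorem tds_harm (n : ℕ) : (harmonic n : ℝ) = ∑ i ∈ Finset.Ioc 0 n, 1 / (i:ℝ) := by
  rw [harmonic_eq_sum_Icc]; push_cast
  simp only [one_div]; rfl

open Finset ArithmeticFunction in
theorem tds_S (n : ℕ) : ∑ q ∈ Ioc 0 n, (q.totient : ℝ) / (q:ℝ)^2 =
    ∑ d ∈ Ioc 0 n, ((moebius d : ℤ) : ℝ) / (d:ℝ)^2 * (harmonic (n / d) : ℝ) := by
  let F : ArithmeticFunction ℝ := ⟨fun d => ((moebius d : ℤ) : ℝ) / (d:ℝ)^2, by simp⟩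
  let G : ArithmeticFunction ℝ := ⟨fun d => 1 / (d:ℝ), by simp⟩
  have := sum_Ioc_mul_eq_sum_sum F G n
  calc _ = ∑ q ∈ Ioc 0 n, (F * G) q := by
        refine Finset.sum_congr rfl fun q hq => ?_
        rw [mul_apply, ← tds_totient_div q (Finset.mem_Ioc.1 hq).1]; rfl
    _ = _ := by
        rw [this]; refine Finset.sum_congr rfl fun q hq => ?_
        rw [tds_harm]; rfl

theorem tds_e (n d : ℕ) (hd : 0 < d) (hn : d ≤ n) :
    |(harmonic (n/d) : ℝ) - (Real.log n - Real.log d + Real.eulerMascheroniConstant)| ≤ 2 * d / n := by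
  set m := n / d with hm
  have hm1 : 1 ≤ m := (Nat.one_le_div_iff hd).2 hn
  have a := Real.eulerMascheroniSeq_lt_eulerMascheroniConstant m
  have b := Real.eulerMascheroniConstant_lt_eulerMascheroniSeq' m
  simp only [Real.eulerMascheroniSeq, Real.eulerMascheroniSeq', if_neg (show m ≠ 0 by omega)] at a b
  have hdR : (0:ℝ) < d := by exact_mod_cast hd
  have hnR : (0:ℝ) < n := by exact_mod_cast (by omega : 0 < n)
  have hmR : (1:ℝ) ≤ m := by exact_mod_cast hm1
  have h1 : (m:ℝ) ≤ n / d := by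
    rw [le_div_iff₀ hdR]; exact_mod_cast Nat.div_mul_le_self n d
  have h2 : (n:ℝ)/d ≤ m + 1 := by
    rw [div_le_iff₀ hdR]; 
    have := Nat.lt_mul_div_succ n hd
    have : n ≤ (m+1) * d := by rw [mul_comm]; exact this.le
    exact_mod_cast this
  have hl : Real.log n - Real.log d = Real.log (n/d) := (Real.log_div hnR.ne' hdR.ne').symm
  have l1 : Real.log m ≤ Real.log (n/d) := Real.log_le_log (by linarith) h1
  have l2 : Real.log (n/d) ≤ Real.log (m+1) := Real.log_le_log (by positivity) h2
  have l3 : Real.log (m+1) - Real.log m ≤ 1 / m := by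
    rw [← Real.log_div (by linarith) (by linarith)]
    have := Real.log_le_sub_one_of_pos (show (0:ℝ) < (m+1)/m by positivity)
    have e : ((m:ℝ)+1)/m - 1 = 1/m := by field_simp; ring
    linarith
  have l4 : (1:ℝ)/m ≤ 2 * d / n := by
    rw [div_le_div_iff₀ (by linarith) hnR]
    have := (div_le_iff₀ hdR).1 h2
    nlinarith
  rw [hl, abs_le]
  constructor <;> linarith

open Finset in
theorem tds_T (n : ℕ) : ∑ q ∈ Ioc 0 n, 1 / (q:ℝ) * (harmonic (n - q) : ℝ) =
   (harmonic n : ℝ)^2 - ∑ q ∈ Ioc 0 n, 1 / (q:ℝ)^2 := by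
  induction n with
  | zero => simp
  | succ n ih =>
    rw [Finset.sum_Ioc_succ_top (by omega), Finset.sum_Ioc_succ_top (by omega)]
    have : ∑ q ∈ Ioc 0 n, 1 / (q:ℝ) * (harmonic (n + 1 - q) : ℝ) =
        ∑ q ∈ Ioc 0 n, 1 / (q:ℝ) * (harmonic (n - q) : ℝ) + 2 * harmonic n / (n+1) := by
      have r : ∑ q ∈ Ioc 0 n, 1 / ((n:ℝ)+1-q) = harmonic n := by
        rw [tds_harm]
        refine Finset.sum_bij' (fun q _ => n+1-q) (fun q _ => n+1-q) ?_ ?_ ?_ ?_ ?_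
        · intro a ha; simp at *; omega
        · intro a ha; simp at *; omega
        · intro a ha; simp at *; omega
        · intro a ha; simp at *; omega
        · intro a ha; simp at ha; rw [Nat.cast_sub (by omega)]; push_cast; rfl
      have : 2 * (harmonic n:ℝ) / (n+1) = ∑ q ∈ Ioc 0 n, (1 / (q:ℝ) + 1 / ((n:ℝ)+1-q)) / (n+1) := by
        rw [← Finset.sum_div, Finset.sum_add_distrib, r, ← tds_harm]; ring
      rw [this, ← Finset.sum_add_distrib]
      refine Finset.sum_congr rfl fun q hq => ?_
      simp at hq
      rw [show n + 1 - q = (n - q) + 1 by omega, harmonic_succ]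
      push_cast [Nat.cast_sub hq.2]
      have h1 : (q:ℝ) ≠ 0 := by exact_mod_cast (by omega : q ≠ 0)
      have h2 : (q:ℝ) ≤ n := by exact_mod_cast hq.2
      have h3 : (n:ℝ) + 1 - q ≠ 0 := by linarith
      have h4 : (n:ℝ) - q + 1 ≠ 0 := by linarith
      have h5 : (n:ℝ) + 1 ≠ 0 := by positivity
      rw [show (n:ℝ) - q + 1 = n + 1 - q by ring]
      field_simp
      ring
    rw [this, ih, harmonic_succ]
    push_cast
    simp
    field_simp
    ring

theorem tds_log2 (d : ℕ) : (1 + Real.log d)^2 / (d:ℝ)^2 ≤ 25 * (1 / (d:ℝ)^(3/2:ℝ)) := by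
  rcases Nat.eq_zero_or_pos d with rfl | hd
  · simp
  have h : (1:ℝ) ≤ d := by exact_mod_cast hd
  have h1 := Real.log_le_rpow_div (show (0:ℝ) ≤ d by positivity) (show (0:ℝ) < 1/4 by norm_num)
  have h2 : (1:ℝ) ≤ (d:ℝ)^(1/4:ℝ) := Real.one_le_rpow h (by norm_num)
  have h0 := Real.log_nonneg h
  have h3 : 1 + Real.log d ≤ 5 * (d:ℝ)^(1/4:ℝ) := by linarith
  have h4 : (1 + Real.log d)^2 ≤ (5 * (d:ℝ)^(1/4:ℝ))^2 := by gcongr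
  have h5 : (d:ℝ)^2 = ((d:ℝ)^(1/4:ℝ))^2 * (d:ℝ)^(3/2:ℝ) := by
    rw [← Real.rpow_natCast, ← Real.rpow_natCast, ← Real.rpow_mul (by positivity), ← Real.rpow_add (by positivity)]; norm_num
  rw [h5, div_le_iff₀ (by positivity)]
  have : (0:ℝ) < (d:ℝ)^(3/2:ℝ) := by positivity
  calc _ ≤ _ := h4
    _ = _ := by field_simp; norm_num

theorem tds_log1 (d : ℕ) (hd : 0 < d) : (1 + Real.log d)^2 ≤ 9 * d := by
  have h : (1:ℝ) ≤ d := by exact_mod_cast hd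
  have h1 := Real.log_le_rpow_div (show (0:ℝ) ≤ d by positivity) (show (0:ℝ) < 1/2 by norm_num)
  have h2 : (1:ℝ) ≤ (d:ℝ)^(1/2:ℝ) := Real.one_le_rpow h (by norm_num)
  have h0 := Real.log_nonneg h
  have h5 : ((d:ℝ)^(1/2:ℝ))^2 = d := by
    rw [← Real.rpow_natCast, ← Real.rpow_mul (by positivity)]; norm_num
  nlinarith

theorem tds_summ : Summable (fun d : ℕ => (1 + Real.log d)^2 / (d:ℝ)^2) := by
  refine Summable.of_nonneg_of_le (fun d => by positivity) tds_log2 ?_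
  exact (Real.summable_one_div_nat_rpow.2 (by norm_num)).mul_left _

open ArithmeticFunction LSeries in
theorem tds_L : (∑' d : ℕ, ((moebius d : ℤ) : ℝ) / (d:ℝ)^2 = 1 / (Real.pi^2/6)) ∧
   (∑' d : ℕ, ((moebius d : ℤ) : ℝ) / (d:ℝ)^2 * Real.log d = zetaDeriv2 / (Real.pi^2/6)^2) := by
  have two : (1:ℝ) < (2:ℂ).re := by norm_num
  have ab : abscissaOfAbsConv (fun n => ((moebius n : ℤ) : ℂ)) < (2:ℂ).re := by
    rw [abscissaOfAbsConv_moebius]; norm_num; exact_mod_cast one_lt_two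
  have z2 : riemannZeta 2 = ((Real.pi^2/6 : ℝ) : ℂ) := by rw [riemannZeta_two]; push_cast; rfl
  have znz := riemannZeta_ne_zero_of_one_lt_re two
  have inv : ∀ s : ℂ, 1 < s.re → LSeries (fun n => ((moebius n : ℤ) : ℂ)) s = (riemannZeta s)⁻¹ := by
    intro s hs
    have := LSeries_zeta_mul_Lseries_moebius hs
    rw [LSeries_zeta_eq_riemannZeta hs] at this
    exact eq_inv_of_mul_eq_one_right this
  have t1 : ∀ d : ℕ, term (fun n => ((moebius n : ℤ) : ℂ)) 2 d = ((((moebius d : ℤ) : ℝ) / (d:ℝ)^2 : ℝ) : ℂ) := by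
    intro d
    rcases Nat.eq_zero_or_pos d with rfl | hd
    · simp
    · rw [term_of_ne_zero hd.ne']; push_cast; norm_cast
  have t2 : ∀ d : ℕ, term (logMul fun n => ((moebius n : ℤ) : ℂ)) 2 d = ((((moebius d : ℤ) : ℝ) / (d:ℝ)^2 * Real.log d : ℝ) : ℂ) := by
    intro d
    rcases Nat.eq_zero_or_pos d with rfl | hd
    · simp
    · rw [term_of_ne_zero hd.ne', logMul, ← Complex.natCast_log]; push_cast
      rw [show ((d:ℂ)^(2:ℂ)) = (d:ℂ)^2 by norm_cast]; ring
  have e1 := inv 2 two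
  rw [LSeries, tsum_congr t1, ← Complex.ofReal_tsum, z2, ← Complex.ofReal_inv] at e1
  refine ⟨by rw [Complex.ofReal_inj.1 e1, one_div], ?_⟩
  have dz : HasDerivAt riemannZeta (deriv riemannZeta 2) 2 :=
    (differentiableAt_riemannZeta (by norm_num)).hasDerivAt
  have d1 := dz.inv znz
  have d2 := LSeries_hasDerivAt ab
  have ev : LSeries (fun n => ((moebius n : ℤ) : ℂ)) =ᶠ[nhds 2] riemannZeta⁻¹ := by
    filter_upwards [(isOpen_lt continuous_const Complex.continuous_re).mem_nhds two] with s hs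
    exact inv s hs
  have d3 := (d1.congr_of_eventuallyEq ev).unique d2
  rw [neg_div, neg_inj, LSeries, tsum_congr t2, ← Complex.ofReal_tsum, z2, ← Complex.ofReal_pow] at d3
  have := congrArg Complex.re d3
  rw [Complex.ofReal_re, Complex.div_ofReal_re] at this
  rw [← this]; rfl

theorem tds_a (d : ℕ) : |((ArithmeticFunction.moebius d : ℤ) : ℝ) / (d:ℝ)^2| ≤ 1 / (d:ℝ)^2 := by
  rw [abs_div, abs_of_nonneg (show (0:ℝ) ≤ (d:ℝ)^2 by positivity)]
  gcongr
  exact_mod_cast ArithmeticFunction.abs_moebius_le_one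

theorem tds_lognn (d : ℕ) : 0 ≤ Real.log d := Real.log_natCast_nonneg d

theorem tds_sa : Summable (fun d : ℕ => ((ArithmeticFunction.moebius d : ℤ) : ℝ) / (d:ℝ)^2) := by
  refine Summable.of_norm_bounded tds_summ fun d => ?_
  refine (tds_a d).trans ?_
  have := tds_lognn d
  gcongr
  nlinarith

theorem tds_sb : Summable (fun d : ℕ => ((ArithmeticFunction.moebius d : ℤ) : ℝ) / (d:ℝ)^2 * Real.log d) := by
  refine Summable.of_norm_bounded tds_summ fun d => ?_
  have := tds_lognn d
  rw [Real.norm_eq_abs, abs_mul, abs_of_nonneg this]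
  refine (mul_le_mul_of_nonneg_right (tds_a d) this).trans ?_
  rw [div_mul_eq_mul_div]
  gcongr
  nlinarith

open Finset in
theorem tds_A : ∃ K : ℝ, ∀ n : ℕ, 1 ≤ n →
    |∑ q ∈ Ioc 0 n, (q.totient : ℝ) / (q:ℝ)^2 - (1 / (Real.pi^2/6) * (Real.log n + Real.eulerMascheroniConstant)
      - zetaDeriv2 / (Real.pi^2/6)^2)| * (1 + Real.log n) ≤ K := by
  refine ⟨∑' d : ℕ, (1 + Real.log d)^2 / (d:ℝ)^2 + 18, fun n hn => ?_⟩
  set γ := Real.eulerMascheroniConstant with hγ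
  have g0 : 1/2 < γ := Real.one_half_lt_eulerMascheroniConstant
  have g1 : γ < 2/3 := Real.eulerMascheroniConstant_lt_two_thirds
  set L := Real.log n with hL
  have L0 : 0 ≤ L := tds_lognn n
  have nR : (1:ℝ) ≤ n := by exact_mod_cast hn
  set a : ℕ → ℝ := fun d => ((ArithmeticFunction.moebius d : ℤ) : ℝ) / (d:ℝ)^2 with ha
  set g : ℕ → ℝ := fun d => (a d * (L + γ) - a d * Real.log d) with hg
  have sg : Summable g := (tds_sa.mul_right _).sub tds_sb
  have tg : ∑' d, g d = 1 / (Real.pi^2/6) * (L + γ) - zetaDeriv2 / (Real.pi^2/6)^2 := by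
    rw [hg, (tds_sa.mul_right _).tsum_sub tds_sb, tsum_mul_right, tds_L.1, tds_L.2]
  rw [← tg, tds_S]
  have split := sg.sum_add_tsum_compl (s := Ioc 0 n)
  have tail : |∑' x : ↑((Ioc 0 n : Finset ℕ) : Set ℕ)ᶜ, g x| * (1 + L) ≤ ∑' d : ℕ, (1 + Real.log d)^2 / (d:ℝ)^2 := by
    have h1 : ‖∑' x : ↑((Ioc 0 n : Finset ℕ) : Set ℕ)ᶜ, g x * (1 + L)‖ ≤
        ∑' x : ↑((Ioc 0 n : Finset ℕ) : Set ℕ)ᶜ, (1 + Real.log (x:ℕ))^2 / ((x:ℕ):ℝ)^2 := by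
      refine tsum_of_norm_bounded (tds_summ.subtype _).hasSum ?_
      rintro ⟨d, hd⟩
      simp only [Set.mem_compl_iff, mem_coe, mem_Ioc, not_and, not_le] at hd
      rcases Nat.eq_zero_or_pos d with rfl | hd0
      · simp [hg, ha]
      have hd1 := hd hd0
      have hl : L ≤ Real.log d := Real.log_le_log (by linarith) (by exact_mod_cast hd1.le)
      have : g d = a d * (L + γ - Real.log d) := by simp only [hg]; ring
      show ‖g d * (1 + L)‖ ≤ (1 + Real.log d)^2 / (d:ℝ)^2
      rw [this, norm_mul, norm_mul, Real.norm_eq_abs, Real.norm_eq_abs, Real.norm_eq_abs,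
        abs_of_nonneg (show 0 ≤ 1 + L by linarith)]
      have b1 : |L + γ - Real.log d| ≤ 1 + Real.log d := by rw [abs_le]; constructor <;> linarith
      have b2 := tds_a d
      calc |a d| * |L + γ - Real.log d| * (1 + L) ≤ (1 / (d:ℝ)^2) * (1 + Real.log d) * (1 + Real.log d) := by
            gcongr
        _ = _ := by ring
    rw [tsum_mul_right, norm_mul, Real.norm_eq_abs, Real.norm_eq_abs, abs_of_nonneg (show 0 ≤ 1 + L by linarith)] at h1
    exact h1.trans (Summable.tsum_subtype_le _ _ (fun d => by positivity) tds_summ)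
  have err : |∑ d ∈ Ioc 0 n, a d * (harmonic (n / d) : ℝ) - ∑ d ∈ Ioc 0 n, g d| * (1 + L) ≤ 18 := by
    have h1 : |∑ d ∈ Ioc 0 n, a d * (harmonic (n / d) : ℝ) - ∑ d ∈ Ioc 0 n, g d| ≤ ∑ d ∈ Ioc 0 n, 2 / n * (1 / (d:ℝ)) := by
      rw [← Finset.sum_sub_distrib]
      refine (Finset.abs_sum_le_sum_abs _ _).trans (Finset.sum_le_sum fun d hd => ?_)
      rw [mem_Ioc] at hd
      have e := tds_e n d hd.1 hd.2
      have : a d * (harmonic (n / d) : ℝ) - g d = a d * ((harmonic (n/d) : ℝ) - (L - Real.log d + γ)) := by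
        simp only [hg]; ring
      rw [this, abs_mul]
      have hd0 : (0:ℝ) < d := by exact_mod_cast hd.1
      calc _ ≤ (1 / (d:ℝ)^2) * (2 * d / n) := by
            gcongr
            exact tds_a d
        _ = _ := by field_simp
    rw [← Finset.mul_sum, ← tds_harm] at h1
    have h2 := harmonic_le_one_add_log n
    have h3 := tds_log1 n hn
    calc _ ≤ (2 / n * (1 + L)) * (1 + L) := by
          gcongr
          exact h1.trans (by gcongr)
      _ = 2 * (1 + L)^2 / n := by ring
      _ ≤ 18 := by rw [div_le_iff₀ (by linarith)]; linarith
  rw [← split]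
  have tri := abs_sub (∑ d ∈ Ioc 0 n, a d * (harmonic (n / d) : ℝ) - ∑ d ∈ Ioc 0 n, g d) (∑' x : ↑((Ioc 0 n : Finset ℕ) : Set ℕ)ᶜ, g x)
  rw [← sub_sub]
  have := mul_le_mul_of_nonneg_right tri (show 0 ≤ 1 + L by linarith)
  rw [add_mul] at this
  linarith

open Finset in
theorem tds_R (n : ℕ) : ∃ R : ℝ, 0 ≤ R ∧ R ≤ ∑' d : ℕ, (1 + Real.log d)^2 / (d:ℝ)^2 ∧
    ∑ q ∈ Ioc 0 n, (q.totient : ℝ) / (q:ℝ)^2 * (harmonic (n - q) : ℝ) =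
    (∑ q ∈ Ioc 0 n, (q.totient : ℝ) / (q:ℝ)^2) * harmonic n - R := by
  have mono : ∀ q, (harmonic (n - q) : ℝ) ≤ harmonic n := by
    intro q
    rw [tds_harm, tds_harm]
    refine Finset.sum_le_sum_of_subset_of_nonneg (Finset.Ioc_subset_Ioc_right (by omega)) ?_
    intros; positivity
  refine ⟨∑ q ∈ Ioc 0 n, (q.totient : ℝ) / (q:ℝ)^2 * (harmonic n - harmonic (n - q) : ℝ), ?_, ?_, ?_⟩
  · refine Finset.sum_nonneg fun q _ => mul_nonneg (by positivity) (by linarith [mono q])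
  · calc _ ≤ ∑ q ∈ Ioc 0 n, 1 / (q:ℝ) * (harmonic n - harmonic (n - q) : ℝ) := by
          refine Finset.sum_le_sum fun q hq => mul_le_mul_of_nonneg_right ?_ (by linarith [mono q])
          rw [mem_Ioc] at hq
          have h0 : (0:ℝ) < q := by exact_mod_cast hq.1
          have h1 : (q.totient : ℝ) ≤ q := by exact_mod_cast Nat.totient_le q
          rw [div_le_div_iff₀ (by positivity) h0]
          nlinarith
      _ = ∑ q ∈ Ioc 0 n, 1 / (q:ℝ)^2 := by
          simp only [mul_sub, Finset.sum_sub_distrib]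
          rw [tds_T, ← Finset.sum_mul, ← tds_harm]; ring
      _ ≤ ∑ d ∈ Ioc 0 n, (1 + Real.log d)^2 / (d:ℝ)^2 := by
          refine Finset.sum_le_sum fun d _ => ?_
          have := tds_lognn d
          gcongr
          nlinarith
      _ ≤ _ := tds_summ.sum_le_tsum _ (fun d _ => by positivity)
  · simp only [mul_sub, Finset.sum_sub_distrib]
    rw [← Finset.sum_mul]; ring

open Finset in
theorem tds_re (U : ℝ) (n : ℕ) (hn : ⌈U⌉₊ = n + 1) :
    ∑ p ∈ (Finset.Ico 1 ⌈U⌉₊ ×ˢ Finset.Ico 1 ⌈U⌉₊).filter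
            (fun p => ((p.1 + p.2 : ℕ) : ℝ) < U),
          (p.2.totient : ℝ) / ((p.1 : ℝ) * (p.2 : ℝ)^2) =
    ∑ q ∈ Ioc 0 n, (q.totient : ℝ) / (q:ℝ)^2 * (harmonic (n - q) : ℝ) := by
  have : ∀ p : ℕ × ℕ, ((p.1 + p.2 : ℕ) : ℝ) < U ↔ p.1 + p.2 < n + 1 := by
    intro p; rw [← hn, Nat.lt_ceil]
  simp only [this, hn]
  simp only [tds_harm, Finset.mul_sum]
  rw [Finset.sum_sigma']
  refine Finset.sum_bij' (fun p _ => ⟨p.2, p.1⟩) (fun p _ => (p.2, p.1)) ?_ ?_ ?_ ?_ ?_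
  · intro a ha; simp at *; omega
  · intro a ha; simp at *; omega
  · intro a ha; rfl
  · intro a ha; rfl
  · intro a ha; simp only; rw [div_mul_div_comm, mul_one, mul_comm]

set_option maxHeartbeats 2000000 in
/-- **Lemma 2.8 (1).** `∑_{k,q ≥ 1, k+q < U} φ(q)/(kq²)
= (log U)²/ζ(2) + (log U/ζ(2))(2γ - ζ'(2)/ζ(2)) + O(1)`
with an absolute implied constant. -/
theorem totient_double_sum_asymptotic :
    ∃ C : ℝ, 0 < C ∧ ∀ U : ℝ, 2 ≤ U →
      |(∑ p ∈ (Finset.Ico 1 ⌈U⌉₊ ×ˢ Finset.Ico 1 ⌈U⌉₊).filter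
            (fun p => ((p.1 + p.2 : ℕ) : ℝ) < U),
          (p.2.totient : ℝ) / ((p.1 : ℝ) * (p.2 : ℝ)^2))
        - (Real.log U)^2 / (Real.pi^2/6)
        - Real.log U / (Real.pi^2/6) *
            (2 * Real.eulerMascheroniConstant - zetaDeriv2 / (Real.pi^2/6))|
      ≤ C := by
  obtain ⟨K, hK⟩ := tds_A
  set T := ∑' d : ℕ, (1 + Real.log d)^2 / (d:ℝ)^2 with hT
  have T0 : 0 ≤ T := tsum_nonneg fun d => by positivity
  set A := 1 / (Real.pi^2/6) with hA
  have A0 : 0 < A := by positivity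
  set B := zetaDeriv2 / (Real.pi^2/6)^2 with hB
  set γ := Real.eulerMascheroniConstant with hγ
  have g0 : 1/2 < γ := Real.one_half_lt_eulerMascheroniConstant
  have g1 : γ < 2/3 := Real.eulerMascheroniConstant_lt_two_thirds
  have K0 : 0 ≤ K := le_trans (mul_nonneg (abs_nonneg _) (by simp)) (hK 1 le_rfl)
  refine ⟨18 * A + (2 * A + |B|) + (A + |B|) + 3 * K + (18 * A + 2 * |B|) + T, by positivity, fun U hU => ?_⟩
  obtain ⟨n, hn⟩ : ∃ n, ⌈U⌉₊ = n + 1 := Nat.exists_eq_succ_of_ne_zero (by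
    have := Nat.ceil_pos.2 (show 0 < U by linarith); omega)
  have U1 : U ≤ n + 1 := by have := Nat.le_ceil U; rw [hn] at this; exact_mod_cast this
  have U2 : (n:ℝ) < U := by rw [← Nat.lt_ceil, hn]; omega
  have n1 : 1 ≤ n := by
    have : (1:ℝ) ≤ n := by linarith
    exact_mod_cast this
  have nR : (1:ℝ) ≤ n := by exact_mod_cast n1
  rw [tds_re U n hn]
  obtain ⟨R, R0, R1, hR⟩ := tds_R n
  rw [hR]
  have hE := hK n n1
  have he := tds_e n 1 one_pos n1
  simp only [Nat.div_one, Nat.cast_one, Real.log_one, sub_zero, mul_one] at he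
  set S := ∑ q ∈ Finset.Ioc 0 n, (q.totient : ℝ) / (q:ℝ)^2
  set H := (harmonic n : ℝ)
  have hl := tds_log1 n n1
  set L := Real.log n with hL
  have L0 : 0 ≤ L := tds_lognn n
  have d0 : L ≤ Real.log U := Real.log_le_log (by linarith) U2.le
  have d1 : Real.log U - L ≤ 1 / n := by
    rw [hL, ← Real.log_div (by linarith) (by linarith)]
    have h1 := Real.log_le_sub_one_of_pos (show (0:ℝ) < U/n by positivity)
    have h2 : U / n - 1 ≤ 1 / n := by
      rw [div_sub_one (by linarith)]; gcongr; linarith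
    linarith
  have q1 : (1 + L) / n ≤ 9 := by
    rw [div_le_iff₀ (by linarith)]; nlinarith
  have q2 : (1:ℝ) / n ≤ 1 := by rw [div_le_iff₀ (by linarith)]; linarith
  obtain ⟨δ, hδ⟩ : ∃ δ, Real.log U = L + δ := ⟨Real.log U - L, by ring⟩
  obtain ⟨E, hE'⟩ : ∃ E, S = A * (L + γ) - B + E := ⟨S - (A * (L + γ) - B), by ring⟩
  obtain ⟨e, he'⟩ : ∃ e, H = L + γ + e := ⟨H - (L + γ), by ring⟩
  rw [he', show L + γ + e - (L + γ) = e by ring] at he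
  rw [hE', show A * (L + γ) - B + E - (A * (L + γ) - B) = E by ring] at hE
  rw [hδ] at d0 d1
  have δ0 : 0 ≤ δ := by linarith
  have δ1 : δ ≤ 1 / n := by linarith
  have δ2 : δ * (1 + L) ≤ 9 := by
    calc _ ≤ 1 / n * (1 + L) := by gcongr
      _ = (1 + L) / n := by ring
      _ ≤ 9 := q1
  have e1 : |e| ≤ 2 := he.trans (by rw [show (2:ℝ)/n = 2 * (1/n) by ring]; linarith)
  have e2 : |e| * (1 + L) ≤ 18 := by
    calc _ ≤ 2 / n * (1 + L) := by gcongr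
      _ = 2 * ((1 + L) / n) := by ring
      _ ≤ 18 := by linarith
  have key : S * H - R - (Real.log U)^2 / (Real.pi^2/6)
        - Real.log U / (Real.pi^2/6) * (2 * γ - zetaDeriv2 / (Real.pi^2/6))
      = -(A * (δ * (2 * L + δ))) + -((2 * γ * A - B) * δ) + (A * γ^2 - B * γ) + E * (L + γ + e)
        + (A * ((L + γ) * e) - B * e) - R := by
    have z : (Real.log U)^2 / (Real.pi^2/6)
        + Real.log U / (Real.pi^2/6) * (2 * γ - zetaDeriv2 / (Real.pi^2/6)) =
        A * (L + δ)^2 + (L + δ) * (2 * γ * A - B) := by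
      rw [hδ, hA, hB]; ring
    rw [sub_sub, z, hE', he']; ring
  rw [key]
  have p1 : |-(A * (δ * (2 * L + δ)))| ≤ 18 * A := by
    rw [abs_neg, abs_of_nonneg (by positivity)]
    have h1 : δ * δ ≤ δ * 1 := mul_le_mul_of_nonneg_left (by linarith) δ0
    have h2 : δ * (2 * L + δ) ≤ 18 := by linarith
    have h3 := mul_le_mul_of_nonneg_left h2 A0.le
    linarith
  have p2 : |-((2 * γ * A - B) * δ)| ≤ 2 * A + |B| := by
    rw [abs_neg, abs_mul, abs_of_nonneg δ0]
    have h1 : |2 * γ * A - B| ≤ 2 * A + |B| := by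
      refine (abs_sub _ _).trans ?_
      rw [abs_of_nonneg (by positivity)]
      have := mul_le_mul_of_nonneg_right (show γ ≤ 1 by linarith) A0.le
      linarith
    have h2 := mul_le_mul_of_nonneg_left (show δ ≤ 1 by linarith) (abs_nonneg (2 * γ * A - B))
    linarith
  have p3 : |A * γ^2 - B * γ| ≤ A + |B| := by
    refine (abs_sub _ _).trans ?_
    rw [abs_of_nonneg (by positivity), abs_mul, abs_of_nonneg (show 0 ≤ γ by linarith)]
    have := abs_nonneg B
    have h2 : γ^2 ≤ 1 := by nlinarith
    have h3 := mul_le_mul_of_nonneg_left h2 A0.le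
    have h4 := mul_le_mul_of_nonneg_left (show γ ≤ 1 by linarith) (abs_nonneg B)
    linarith
  have p4 : |E * (L + γ + e)| ≤ 3 * K := by
    rw [abs_mul]
    have : |L + γ + e| ≤ 3 * (1 + L) := by
      refine (abs_add_le _ _).trans ?_
      rw [abs_of_nonneg (show 0 ≤ L + γ by linarith)]; linarith
    have := mul_le_mul_of_nonneg_left this (abs_nonneg E)
    linarith
  have p5 : |A * ((L + γ) * e) - B * e| ≤ 18 * A + 2 * |B| := by
    refine (abs_sub _ _).trans ?_
    rw [abs_mul, abs_mul, abs_mul, abs_of_pos A0, abs_of_nonneg (show 0 ≤ L + γ by linarith)]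
    have := abs_nonneg B
    have h0 := abs_nonneg e
    have h1 := mul_le_mul_of_nonneg_right (show γ ≤ 1 by linarith) h0
    have h2 : (L + γ) * |e| ≤ 18 := by linarith
    have h3 := mul_le_mul_of_nonneg_left h2 A0.le
    have h4 := mul_le_mul_of_nonneg_left e1 (abs_nonneg B)
    linarith
  rw [abs_le] at p1 p2 p3 p4 p5 ⊢
  constructor <;> linarith
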